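/- Let X be a random variable in a standard Borel space S, G a σ-algebra generated by a random element ξ, and M a random element such that X is conditionally independent of M given G. Then there exists a measurable function h and a uniform random variable U on (0,1) independent of (M, G) such that X = h(ξ, U) almost surely. -/

import Mathlib

open MeasureTheory ProbabilityTheory

open scoped unitInterval ENNReal

/-- If `X` is conditionally independent of `M` given `σ(ξ)`, then the joint law of `((M, ξ), X)`
is obtained from the law of `(M, ξ)` through the conditional distribution of `X` given `ξ`. -/
theorem map_prodMk_eq_compProd_condDistrib_of_condExp_mul {Ω S E E' : Type*} [MeasurableSpace Ω]
    [MeasurableSpace S] [StandardBorelSpace S] [Nonempty S]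
    [MeasurableSpace E] [MeasurableSpace E']
    (μ : Measure Ω) [IsFiniteMeasure μ]
    {X : Ω → S} (hX : Measurable X) {ξ : Ω → E} (hξ : Measurable ξ)
    {M : Ω → E'} (hM : Measurable M)
    (hCI : ∀ (A : Set S) (B : Set E'), MeasurableSet A → MeasurableSet B →
      μ[fun ω => Set.indicator A (fun _ => (1 : ℝ)) (X ω) *
            Set.indicator B (fun _ => (1 : ℝ)) (M ω) | MeasurableSpace.comap ξ inferInstance]
        =ᵐ[μ] fun ω =>
          (μ[fun ω' => Set.indicator A (fun _ => (1 : ℝ)) (X ω')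
              | MeasurableSpace.comap ξ inferInstance]) ω *
          (μ[fun ω' => Set.indicator B (fun _ => (1 : ℝ)) (M ω')
              | MeasurableSpace.comap ξ inferInstance]) ω) :
    μ.map (fun ω => ((M ω, ξ ω), X ω)) =
      μ.map (fun ω => (M ω, ξ ω)) ⊗ₘ (condDistrib X ξ μ).prodMkLeft E' := by
  rw [Measure.ext_prod₃_iff']
  intro B C A hB hC hA
  have hMξ : Measurable (fun ω => (M ω, ξ ω)) := hM.prodMk hξ
  set κ := condDistrib X ξ μ
  have hm : MeasurableSpace.comap ξ inferInstance ≤ (inferInstance : MeasurableSpace Ω) :=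
    hξ.comap_le
  have hCm : MeasurableSet[MeasurableSpace.comap ξ inferInstance] (ξ ⁻¹' C) := ⟨C, hC, rfl⟩
  have hmeasA : Measurable fun ω => Set.indicator A (fun _ => (1 : ℝ)) (X ω) :=
    (measurable_const.indicator hA).comp hX
  have hmeasB : Measurable fun ω => Set.indicator B (fun _ => (1 : ℝ)) (M ω) :=
    (measurable_const.indicator hB).comp hM
  have hle (T : Set S) (x : S) : ‖Set.indicator T (fun _ => (1 : ℝ)) x‖ ≤ 1 := by
    by_cases h : x ∈ T <;> simp [h]
  have hle' (T : Set E') (x : E') : ‖Set.indicator T (fun _ => (1 : ℝ)) x‖ ≤ 1 := by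
    by_cases h : x ∈ T <;> simp [h]
  have hintB : Integrable (fun ω => Set.indicator B (fun _ => (1 : ℝ)) (M ω)) μ :=
    Integrable.of_bound hmeasB.aestronglyMeasurable 1 (.of_forall fun ω => hle' _ _)
  have hintAB : Integrable (fun ω => Set.indicator A (fun _ => (1 : ℝ)) (X ω) *
      Set.indicator B (fun _ => (1 : ℝ)) (M ω)) μ :=
    hintB.bdd_mul hmeasA.aestronglyMeasurable (.of_forall fun ω => hle _ _)
  have hκA : (fun ω => (κ (ξ ω)).real A) =ᵐ[μ]
      μ[fun ω => Set.indicator A (fun _ => (1 : ℝ)) (X ω) |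
        MeasurableSpace.comap ξ inferInstance] :=
    condDistrib_ae_eq_condExp hξ hX hA
  have hκm : Measurable fun e => (κ e).real A := (κ.measurable_coe hA).ennreal_toReal
  have hκsm : StronglyMeasurable[MeasurableSpace.comap ξ inferInstance]
      fun ω => (κ (ξ ω)).real A :=
    (hκm.comp (comap_measurable ξ)).stronglyMeasurable
  have hint : Integrable (fun ω => (κ (ξ ω)).real A *
      Set.indicator B (fun _ => (1 : ℝ)) (M ω)) μ :=
    hintB.bdd_mul (c := 1) (hκm.comp hξ).aestronglyMeasurable (.of_forall fun ω => by
      rw [Real.norm_of_nonneg measureReal_nonneg]; exact measureReal_le_one)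
  have key : ∫ ω in ξ ⁻¹' C, Set.indicator A (fun _ => (1 : ℝ)) (X ω) *
        Set.indicator B (fun _ => (1 : ℝ)) (M ω) ∂μ
      = ∫ ω in ξ ⁻¹' C, (κ (ξ ω)).real A * Set.indicator B (fun _ => (1 : ℝ)) (M ω) ∂μ := by
    rw [← setIntegral_condExp hm hintAB hCm, ← setIntegral_condExp hm hint hCm]
    refine setIntegral_congr_ae (hm _ hCm) ?_
    filter_upwards [hCI A B hA hB, hκA,
      condExp_mul_of_stronglyMeasurable_left hκsm hint hintB] with ω h1 h2 h3 _
    rw [h1, ← h2]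
    exact h3.symm
  have hlhs : ∫ ω in ξ ⁻¹' C, Set.indicator A (fun _ => (1 : ℝ)) (X ω) *
      Set.indicator B (fun _ => (1 : ℝ)) (M ω) ∂μ
      = μ.real ((fun ω => ((M ω, ξ ω), X ω)) ⁻¹' ((B ×ˢ C) ×ˢ A)) := by
    rw [← integral_indicator_one ((hMξ.prodMk hX) ((hB.prod hC).prod hA)),
      ← integral_indicator (hξ hC)]
    congr with ω
    by_cases h1 : ξ ω ∈ C <;> by_cases h2 : X ω ∈ A <;> by_cases h3 : M ω ∈ B <;>
      simp [Set.indicator, h1, h2, h3]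
  have hrhs : ∫⁻ ω in ξ ⁻¹' C, ENNReal.ofReal ((κ (ξ ω)).real A *
      Set.indicator B (fun _ => (1 : ℝ)) (M ω)) ∂μ
      = (μ.map (fun ω => (M ω, ξ ω)) ⊗ₘ κ.prodMkLeft E') ((B ×ˢ C) ×ˢ A) := by
    rw [Measure.compProd_apply_prod (hB.prod hC) hA, setLIntegral_map (hB.prod hC)
      (Kernel.measurable_coe _ hA) hMξ, ← lintegral_indicator (hξ hC),
      ← lintegral_indicator (hMξ (hB.prod hC))]
    congr with ω
    by_cases h1 : ξ ω ∈ C <;> by_cases h3 : M ω ∈ B <;>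
      simp [Set.indicator, h1, h3]
  rw [Measure.map_apply (hMξ.prodMk hX) ((hB.prod hC).prod hA), ← hrhs,
    ← ofReal_integral_eq_lintegral_ofReal hint.integrableOn (.of_forall fun ω =>
      mul_nonneg measureReal_nonneg (Set.indicator_nonneg (by simp) _)), ← key, hlhs,
    ofReal_measureReal]

/-- Inversion of a randomization: if `f e` pushes the uniform law to `κ e` for every `e`, then a
uniform variable `V` with `f e V = x` can be sampled measurably from `(e, x)` and a fresh
uniform variable. -/
theorem exists_measurable_lintegral_eq_of_map_eq {S E : Type*}
    [MeasurableSpace S] [StandardBorelSpace S] [MeasurableSpace E]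
    (κ : Kernel E S) [IsMarkovKernel κ] {f : E → I → S} (hf : Measurable (Function.uncurry f))
    (hfκ : ∀ e, volume.map (f e) = κ e) :
    ∃ g : E × S → I → I, Measurable (Function.uncurry g) ∧
      ∀ e (F : S × I → ℝ≥0∞), Measurable F →
        ∫⁻ x, (∫⁻ t, F (x, g (e, x) t)) ∂κ e = ∫⁻ t, F (f e t, t) := by
  have hfm : Measurable fun p : E × I => (f p.1 p.2, p.2) := hf.prodMk measurable_snd
  let η : Kernel E (S × I) :=
    (Kernel.deterministic id measurable_id ×ₖ Kernel.const E (volume : Measure I)).map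
      (fun p : E × I => (f p.1 p.2, p.2))
  have : IsMarkovKernel η := Kernel.IsMarkovKernel.map _ hfm
  have hη (e : E) : η e = volume.map (fun t => (f e t, t)) := by
    rw [Kernel.map_apply _ hfm, Kernel.prod_apply, Kernel.deterministic_apply,
      Kernel.const_apply, id, Measure.dirac_prod, Measure.map_map hfm (by fun_prop)]
    rfl
  have hfst : η.fst = κ := by
    ext1 e
    rw [Kernel.fst_apply, hη, Measure.map_map measurable_fst (by fun_prop), ← hfκ]
    rfl
  obtain ⟨g, hg, hgη⟩ := Kernel.exists_measurable_map_eq_unitInterval η.condKernel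
  refine ⟨g, hg, fun e F hF => ?_⟩
  calc ∫⁻ x, (∫⁻ t, F (x, g (e, x) t)) ∂κ e
      = ∫⁻ x, ∫⁻ v, F (x, v) ∂η.condKernel (e, x) ∂κ e := by
        refine lintegral_congr fun x => ?_
        rw [← hgη, lintegral_map (by fun_prop) (by fun_prop)]
    _ = ∫⁻ p, F p ∂η e := by
        rw [← hfst, ← Kernel.lintegral_compProd _ _ _ hF, Kernel.disintegrate]
    _ = ∫⁻ t, F (f e t, t) := by
        rw [hη, lintegral_map hF (by fun_prop)]

/-- The uniform law on `(0, 1)` induces the uniform law on the unit interval. -/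
theorem map_projIcc_restrict_Ioo :
    (volume.restrict (Set.Ioo (0 : ℝ) 1)).map (Set.projIcc 0 1 zero_le_one) =
      (volume : Measure I) := by
  have h := unitInterval.measurePreserving_coe
  rw [restrict_Ioo_eq_restrict_Icc, ← h.map_eq,
    Measure.map_map continuous_projIcc.measurable h.measurable]
  exact (congrArg (Measure.map · volume)
    (funext fun t => Set.projIcc_val (zero_le_one' ℝ) t)).trans Measure.map_id

/-- Functional representation of conditional independence (Kallenberg, Prop. 6.13): let `X` be
a random variable in a standard Borel space `S`, `G = σ(ξ)` the σ-algebra generated by a random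
element `ξ`, and `M` a random element such that `X` is conditionally independent of `M` given
`G` (product formula for conditional probabilities).  If the probability space is rich enough
to support a uniform variable independent of `(X, M, ξ)`, then there exist a measurable
`h : E × ℝ → S` and a uniform random variable `U` on `(0,1)` independent of `(M, ξ)` with
`X = h (ξ, U)` almost surely. -/
theorem functional_representation_condIndep {Ω S E E' : Type*} [MeasurableSpace Ω]
    [MeasurableSpace S] [StandardBorelSpace S] [MeasurableSpace E] [MeasurableSpace E']
    (μ : Measure Ω) [IsProbabilityMeasure μ]
    (X : Ω → S) (hX : Measurable X) (ξ : Ω → E) (hξ : Measurable ξ)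
    (M : Ω → E') (hM : Measurable M)
    (hCI : ∀ (A : Set S) (B : Set E'), MeasurableSet A → MeasurableSet B →
      μ[fun ω => Set.indicator A (fun _ => (1 : ℝ)) (X ω) *
            Set.indicator B (fun _ => (1 : ℝ)) (M ω) | MeasurableSpace.comap ξ inferInstance]
        =ᵐ[μ] fun ω =>
          (μ[fun ω' => Set.indicator A (fun _ => (1 : ℝ)) (X ω')
              | MeasurableSpace.comap ξ inferInstance]) ω *
          (μ[fun ω' => Set.indicator B (fun _ => (1 : ℝ)) (M ω')
              | MeasurableSpace.comap ξ inferInstance]) ω)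
    (hRich : ∃ θ : Ω → ℝ, Measurable θ ∧
      Measure.map θ μ = volume.restrict (Set.Ioo (0 : ℝ) 1) ∧
      IndepFun θ (fun ω => (X ω, M ω, ξ ω)) μ) :
    ∃ (h : E × ℝ → S) (U : Ω → ℝ), Measurable h ∧ Measurable U ∧
      Measure.map U μ = volume.restrict (Set.Ioo (0 : ℝ) 1) ∧
      IndepFun U (fun ω => (M ω, ξ ω)) μ ∧
      ∀ᵐ ω ∂μ, X ω = h (ξ ω, U ω) := by
  have : Nonempty Ω := nonempty_of_isProbabilityMeasure μ
  have : Nonempty S := this.map X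
  obtain ⟨θ, hθ, hθμ, hind⟩ := hRich
  obtain ⟨f, hf, hfκ⟩ := Kernel.exists_measurable_map_eq_unitInterval (condDistrib X ξ μ)
  obtain ⟨g, hg, hgF⟩ := exists_measurable_lintegral_eq_of_map_eq _ hf hfκ
  have hMξ : Measurable (fun ω => (M ω, ξ ω)) := hM.prodMk hξ
  have hproj : Measurable (Set.projIcc (0 : ℝ) 1 zero_le_one) := continuous_projIcc.measurable
  let T : Ω → I := fun ω => Set.projIcc 0 1 zero_le_one (θ ω)
  have hT : Measurable T := hproj.comp hθ
  have hTμ : μ.map T = volume := by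
    rw [← map_projIcc_restrict_Ioo, ← hθμ, Measure.map_map hproj hθ]
    rfl
  have hTind : μ.map (fun ω => (((M ω, ξ ω), X ω), T ω)) =
      (μ.map (fun ω => ((M ω, ξ ω), X ω))).prod volume := by
    rw [← hTμ]
    exact (indepFun_iff_map_prod_eq_prod_map_map (hMξ.prodMk hX).aemeasurable hT.aemeasurable).1
      (hind.symm.comp (φ := fun p : S × E' × E => (p.2, p.1)) (by fun_prop) hproj)
  let V : Ω → I := fun ω => g (ξ ω, X ω) (T ω)
  have hV : Measurable V := hg.comp ((hξ.prodMk hX).prodMk hT)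
  have hfm : Measurable fun q : (E' × E) × I => (q.1, f q.1.2 q.2, q.2) := by fun_prop
  have hlaw : μ.map (fun ω => ((M ω, ξ ω), X ω, V ω)) =
      ((μ.map (fun ω => (M ω, ξ ω))).prod volume).map
        (fun q : (E' × E) × I => (q.1, f q.1.2 q.2, q.2)) := by
    refine Measure.ext_of_lintegral _ fun F hF => ?_
    rw [lintegral_map hF (by fun_prop), lintegral_map hF hfm,
      lintegral_prod _ (by fun_prop)]
    have hG : Measurable fun q : ((E' × E) × S) × I =>
        F (q.1.1, q.1.2, g (q.1.1.2, q.1.2) q.2) := by fun_prop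
    calc ∫⁻ ω, F ((M ω, ξ ω), X ω, V ω) ∂μ
        = ∫⁻ q, F (q.1.1, q.1.2, g (q.1.1.2, q.1.2) q.2)
            ∂μ.map (fun ω => (((M ω, ξ ω), X ω), T ω)) :=
          (lintegral_map hG ((hMξ.prodMk hX).prodMk hT)).symm
      _ = ∫⁻ p, ∫⁻ x, (∫⁻ t, F (p, x, g (p.2, x) t)) ∂condDistrib X ξ μ p.2
            ∂μ.map (fun ω => (M ω, ξ ω)) := by
          rw [hTind, lintegral_prod _ hG.aemeasurable,
            map_prodMk_eq_compProd_condDistrib_of_condExp_mul μ hX hξ hM hCI,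
            Measure.lintegral_compProd hG.lintegral_prod_right']
          rfl
      _ = _ := lintegral_congr fun p => hgF p.2 (fun q => F (p, q)) (by fun_prop)
  have hVlaw : μ.map (fun ω => ((M ω, ξ ω), V ω)) =
      (μ.map (fun ω => (M ω, ξ ω))).prod volume := by
    have h := congrArg (Measure.map (fun q : (E' × E) × S × I => (q.1, q.2.2))) hlaw
    rw [Measure.map_map (by fun_prop) (by fun_prop), Measure.map_map (by fun_prop) hfm] at h
    exact h.trans Measure.map_id
  have hVμ : μ.map V = volume := by
    have h := congrArg Measure.snd hVlaw
    have := Measure.isProbabilityMeasure_map (μ := μ) hMξ.aemeasurable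
    rwa [Measure.snd_prod, Measure.snd_map_prodMk hMξ] at h
  have hVind : IndepFun (fun ω => (M ω, ξ ω)) V μ := by
    rw [indepFun_iff_map_prod_eq_prod_map_map hMξ.aemeasurable hV.aemeasurable, hVlaw, hVμ]
  refine ⟨fun p => f p.1 (Set.projIcc 0 1 zero_le_one p.2), fun ω => V ω, by fun_prop,
    by fun_prop, ?_, (hVind.comp measurable_id measurable_subtype_coe).symm, ?_⟩
  · rw [restrict_Ioo_eq_restrict_Icc, ← unitInterval.measurePreserving_coe.map_eq, ← hVμ,
      Measure.map_map measurable_subtype_coe hV]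
    rfl
  · have hset : MeasurableSet {q : (E' × E) × S × I | q.2.1 = f q.1.2 q.2.2} :=
      measurableSet_eq_fun (by fun_prop) (by fun_prop)
    have h : ∀ᵐ q ∂μ.map (fun ω => ((M ω, ξ ω), X ω, V ω)), q.2.1 = f q.1.2 q.2.2 := by
      rw [hlaw, ae_map_iff hfm.aemeasurable hset]
      exact .of_forall fun _ => rfl
    filter_upwards [ae_of_ae_map (by fun_prop) h] with ω hω
    simpa using hω
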